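/- Suppose (U'₁,U'₂,<') is the result of applying a coherent extended Nielsen transformation to a coherent extended word equation (U₁,U₂,<). If the cut graph G_{U₁,U₂,<} is acyclic, then so is the cut graph G_{U'₁,U'₂,<'}. -/

import Mathlib

open scoped Classical

namespace ExtWordEq

/-- The type of (candidate) boundary orders: relations on pairs (i,j). -/
abbrev BRel : Type := ℕ × ℕ → ℕ × ℕ → Prop

variable {X : Type*}

/-- The `i`-th side of the word equation (`i = 1` gives `U₁`, anything else `U₂`). -/
def word (U₁ U₂ : List X) (i : ℕ) : List X := if i = 1 then U₁ else U₂

/-- The variable `U_{i,j}` (1-indexed), as an optional value. -/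
def letter (U₁ U₂ : List X) (b : ℕ × ℕ) : Option X := (word U₁ U₂ b.1)[b.2 - 1]?

/-- `b` is a boundary of the word equation `(U₁, U₂)`. -/
def Boundary (U₁ U₂ : List X) (b : ℕ × ℕ) : Prop :=
  (b.1 = 1 ∨ b.1 = 2) ∧ 1 ≤ b.2 ∧ b.2 ≤ (word U₁ U₂ b.1).length

/-- `b` is a boundary of `(U₁, U₂)` or one of the conventional boundaries `(1,0)`, `(2,0)`. -/
def EBoundary (U₁ U₂ : List X) (b : ℕ × ℕ) : Prop :=
  (b.1 = 1 ∨ b.1 = 2) ∧ b.2 ≤ (word U₁ U₂ b.1).length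

/-- Incomparability `a ≈ b` for a strict order. -/
def Incomp (lt : BRel) (a b : ℕ × ℕ) : Prop := ¬ lt a b ∧ ¬ lt b a

/-- `lt` is a boundary order for the word equation `(U₁, U₂)`:
a strict weak order on the boundaries (together with the conventional boundaries
`(1,0) ≈ (2,0)`), extending `(i,j) < (i,j+1)` and with `(1,m) ≈ (2,n)`. -/
structure BoundaryOrder (U₁ U₂ : List X) (lt : BRel) : Prop where
  irrefl : ∀ a, EBoundary U₁ U₂ a → ¬ lt a a
  trans : ∀ a b c, EBoundary U₁ U₂ a → EBoundary U₁ U₂ b → EBoundary U₁ U₂ c →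
    lt a b → lt b c → lt a c
  incomp_trans : ∀ a b c, EBoundary U₁ U₂ a → EBoundary U₁ U₂ b → EBoundary U₁ U₂ c →
    Incomp lt a b → Incomp lt b c → Incomp lt a c
  succ : ∀ i j : ℕ, EBoundary U₁ U₂ (i, j + 1) → lt (i, j) (i, j + 1)
  top : Incomp lt (1, U₁.length) (2, U₂.length)
  bot : Incomp lt (1, 0) (2, 0)

/-- `L(U_{i,1} U_{i,2} ⋯ U_{i,j})` where `L` is the additive extension of a length
assignment on variables. -/
def prefixLen (U₁ U₂ : List X) (L : X → ℕ) (b : ℕ × ℕ) : ℕ :=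
  (((word U₁ U₂ b.1).take b.2).map L).sum

/-- The extended word equation `(U₁, U₂, lt)` is coherent. -/
def Coherent (U₁ U₂ : List X) (lt : BRel) : Prop :=
  ∃ L : X → ℕ, (∀ x, 0 < L x) ∧
    ∀ a b, Boundary U₁ U₂ a → Boundary U₁ U₂ b →
      (lt a b ↔ prefixLen U₁ U₂ L a < prefixLen U₁ U₂ L b)

/-- The boundary `a` cuts the boundary `b`. -/
def Cuts (U₁ U₂ : List X) (lt : BRel) (a b : ℕ × ℕ) : Prop :=
  Boundary U₁ U₂ a ∧ Boundary U₁ U₂ b ∧ a ≠ b ∧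
    lt (a.1, a.2 - 1) b ∧ lt (b.1, b.2 - 1) a

/-- The boundary `a` mirrors the boundary `b`. -/
def Mirrors (U₁ U₂ : List X) (lt : BRel) (a b : ℕ × ℕ) : Prop :=
  Boundary U₁ U₂ a ∧ Boundary U₁ U₂ b ∧ letter U₁ U₂ a = letter U₁ U₂ b ∧
    (¬ Incomp lt a b ∨ ¬ Incomp lt (a.1, a.2 - 1) (b.1, b.2 - 1))

/-- Edge relation of the cut graph `G_{U₁,U₂,<}`. -/
def CutEdge (U₁ U₂ : List X) (lt : BRel) (a b : ℕ × ℕ) : Prop :=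
  ∃ c, Cuts U₁ U₂ lt a c ∧ Mirrors U₁ U₂ lt c b

/-- `w 0, w 1, …, w n` is a cycle (of length `n ≥ 1`) in the cut graph. -/
def IsCycle (U₁ U₂ : List X) (lt : BRel) (n : ℕ) (w : ℕ → ℕ × ℕ) : Prop :=
  0 < n ∧ w n = w 0 ∧ ∀ k < n, CutEdge U₁ U₂ lt (w k) (w (k + 1))

/-- The cut graph `G_{U₁,U₂,<}` is acyclic. -/
def Acyclic (U₁ U₂ : List X) (lt : BRel) : Prop :=
  ¬ ∃ n w, IsCycle U₁ U₂ lt n w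

variable [DecidableEq X]

/-- Case I extended Nielsen transformation (here `x = U_{1,1}`, `y = U_{2,1}`,
and `T(y) = x`). -/
def NielsenI (U₁ U₂ : List X) (lt : BRel) (U₁' U₂' : List X) (lt' : BRel) : Prop :=
  ∃ x y : X, U₁.head? = some x ∧ U₂.head? = some y ∧
    Incomp lt (1, 1) (2, 1) ∧
    U₁' = (U₁.map fun z => if z = y then x else z).tail ∧
    U₂' = (U₂.map fun z => if z = y then x else z).tail ∧
    BoundaryOrder U₁' U₂' lt' ∧
    ∀ a b : ℕ × ℕ, EBoundary U₁' U₂' a → EBoundary U₁' U₂' b →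
      (lt' a b ↔ lt (a.1, a.2 + 1) (b.1, b.2 + 1))

/-- The substitution `T(x) = y x` (identity on other variables), applied to a word. -/
def expand (x y : X) (l : List X) : List X :=
  l.flatMap fun z => if z = x then [y, x] else [z]

/-- The map `μ(i,j) = j + #{j' ≤ j : U_{i,j'} = x} − 1` (as a map on boundaries),
where `x = U_{1,1}`. -/
def mu (U₁ U₂ : List X) (x : X) (b : ℕ × ℕ) : ℕ × ℕ :=
  (b.1, b.2 + ((word U₁ U₂ b.1).take b.2).count x - 1)

/-- The map `ν(i,j) = j − #{j' ≤ j : U'_{i,j'} = x} + 1` (as a map on boundaries),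
where `x = U_{1,1}`. -/
def nu (U₁' U₂' : List X) (x : X) (b : ℕ × ℕ) : ℕ × ℕ :=
  (b.1, b.2 - ((word U₁' U₂' b.1).take b.2).count x + 1)

/-- Membership in `B⁻ = B ∖ {(2,1)}`. -/
def Bminus (U₁ U₂ : List X) (b : ℕ × ℕ) : Prop := Boundary U₁ U₂ b ∧ b ≠ (2, 1)

/-- Membership in `B'⁻ = {(i, μ(i,j)) : (i,j) ∈ B⁻}` (`x = U_{1,1}`). -/
def Bpminus (U₁ U₂ : List X) (x : X) (b' : ℕ × ℕ) : Prop :=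
  ∃ b, Bminus U₁ U₂ b ∧ mu U₁ U₂ x b = b'

/-- Case II extended Nielsen transformation, with the heads `x = U_{1,1}`,
`y = U_{2,1}` made explicit. -/
def NielsenIIxy (U₁ U₂ : List X) (lt : BRel) (U₁' U₂' : List X) (lt' : BRel)
    (x y : X) : Prop :=
  U₁.head? = some x ∧ U₂.head? = some y ∧
  lt (2, 1) (1, 1) ∧
  U₁' = (expand x y U₁).tail ∧
  U₂' = (expand x y U₂).tail ∧
  BoundaryOrder U₁' U₂' lt' ∧
  ∀ a b, Bpminus U₁ U₂ x a → Bpminus U₁ U₂ x b →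
    (lt' a b ↔ lt (nu U₁' U₂' x a) (nu U₁' U₂' x b))

/-- Case II extended Nielsen transformation. -/
def NielsenII (U₁ U₂ : List X) (lt : BRel) (U₁' U₂' : List X) (lt' : BRel) : Prop :=
  ∃ x y : X, NielsenIIxy U₁ U₂ lt U₁' U₂' lt' x y

/-- The dual boundary order. -/
def dualRel (lt : BRel) : BRel := fun a b => lt (3 - a.1, a.2) (3 - b.1, b.2)

/-- Case III extended Nielsen transformation: case II applied to the dual,
then dualized back. -/
def NielsenIII (U₁ U₂ : List X) (lt : BRel) (U₁' U₂' : List X) (lt' : BRel) : Prop :=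
  NielsenII U₂ U₁ (dualRel lt) U₂' U₁' (dualRel lt')

/-- `(U₁', U₂', lt')` is an extended Nielsen transformation of the nontrivial coherent
extended word equation `(U₁, U₂, lt)`. -/
def ExtNielsen (U₁ U₂ : List X) (lt : BRel) (U₁' U₂' : List X) (lt' : BRel) : Prop :=
  U₁ ≠ [] ∧ U₂ ≠ [] ∧ BoundaryOrder U₁ U₂ lt ∧ Coherent U₁ U₂ lt ∧
    (NielsenI U₁ U₂ lt U₁' U₂' lt' ∨ NielsenII U₁ U₂ lt U₁' U₂' lt' ∨
      NielsenIII U₁ U₂ lt U₁' U₂' lt')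

/-- A coherent extended Nielsen transformation. -/
def CohNielsen (U₁ U₂ : List X) (lt : BRel) (U₁' U₂' : List X) (lt' : BRel) : Prop :=
  ExtNielsen U₁ U₂ lt U₁' U₂' lt' ∧ Coherent U₁' U₂' lt'

/-- `(U₁, U₂, lt)` is (strongly) terminating: there is no infinite sequence of coherent
extended Nielsen transformations starting from it. -/
def Terminating (U₁ U₂ : List X) (lt : BRel) : Prop :=
  ¬ ∃ f : ℕ → List X × List X × BRel,
    f 0 = (U₁, U₂, lt) ∧
    ∀ n, CohNielsen (f n).1 (f n).2.1 (f n).2.2 (f (n + 1)).1 (f (n + 1)).2.1 (f (n + 1)).2.2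


section PrefixLen

variable {X : Type*} {U₁ U₂ : List X} {L : X → ℕ}

theorem Boundary.eBoundary {b : ℕ × ℕ} (h : Boundary U₁ U₂ b) : EBoundary U₁ U₂ b :=
  ⟨h.1, h.2.2⟩

theorem Boundary.eBoundary_pred {b : ℕ × ℕ} (h : Boundary U₁ U₂ b) :
    EBoundary U₁ U₂ (b.1, b.2 - 1) :=
  ⟨h.1, (Nat.sub_le _ _).trans h.2.2⟩

theorem prefixLen_zero (i : ℕ) : prefixLen U₁ U₂ L (i, 0) = 0 := by
  simp [prefixLen]

theorem prefixLen_mono {i j k : ℕ} (h : j ≤ k) :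
    prefixLen U₁ U₂ L (i, j) ≤ prefixLen U₁ U₂ L (i, k) := by
  obtain ⟨t, ht⟩ := List.take_prefix_take_left (l := word U₁ U₂ i) h
  simp only [prefixLen]
  rw [← ht, List.map_append, List.sum_append]
  exact Nat.le_add_right _ _

theorem prefixLen_one {i : ℕ} {z : X} (h : (word U₁ U₂ i).head? = some z) :
    prefixLen U₁ U₂ L (i, 1) = L z := by
  obtain ⟨v, hv⟩ := List.head?_eq_some_iff.1 h
  simp [prefixLen, hv]

/-- A boundary splits its side around the corresponding letter. -/
theorem Boundary.exists_split {b : ℕ × ℕ} (h : Boundary U₁ U₂ b) :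
    ∃ u z v, word U₁ U₂ b.1 = u ++ z :: v ∧ u.length = b.2 - 1 := by
  obtain ⟨-, h1, h2⟩ := h
  have hlt : b.2 - 1 < (word U₁ U₂ b.1).length := by omega
  refine ⟨(word U₁ U₂ b.1).take (b.2 - 1), (word U₁ U₂ b.1)[b.2 - 1],
    (word U₁ U₂ b.1).drop (b.2 - 1 + 1), ?_, by simp; omega⟩
  rw [List.cons_getElem_drop_succ, List.take_append_drop]

theorem boundary_of_split {b : ℕ × ℕ} (hi : b.1 = 1 ∨ b.1 = 2) (h1 : 1 ≤ b.2) {u v : List X}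
    {z : X} (h : word U₁ U₂ b.1 = u ++ z :: v) (hu : u.length = b.2 - 1) :
    Boundary U₁ U₂ b := by
  refine ⟨hi, h1, ?_⟩
  rw [h, List.length_append, List.length_cons]
  omega

theorem letter_of_split {b : ℕ × ℕ} {u v : List X} {z : X}
    (h : word U₁ U₂ b.1 = u ++ z :: v) (hu : u.length = b.2 - 1) :
    letter U₁ U₂ b = some z := by
  simp [letter, h, ← hu]

theorem prefixLen_pred_of_split {b : ℕ × ℕ} {u v : List X} {z : X}
    (h : word U₁ U₂ b.1 = u ++ z :: v) (hu : u.length = b.2 - 1) :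
    prefixLen U₁ U₂ L (b.1, b.2 - 1) = (u.map L).sum := by
  simp [prefixLen, h, ← hu]

theorem prefixLen_of_split {b : ℕ × ℕ} (h1 : 1 ≤ b.2) {u v : List X} {z : X}
    (h : word U₁ U₂ b.1 = u ++ z :: v) (hu : u.length = b.2 - 1) :
    prefixLen U₁ U₂ L b = (u.map L).sum + L z := by
  obtain ⟨i, j⟩ := b
  obtain rfl : j = u.length + 1 := by simp only at hu h1; omega
  simp only at h
  simp [prefixLen, h, List.take_append, List.take_of_length_le]

theorem letter_inj_prefixLen {b c : ℕ × ℕ} (hb : Boundary U₁ U₂ b) (hc : Boundary U₁ U₂ c)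
    (h : letter U₁ U₂ b = letter U₁ U₂ c)
    (hlo : prefixLen U₁ U₂ L (b.1, b.2 - 1) = prefixLen U₁ U₂ L (c.1, c.2 - 1)) :
    prefixLen U₁ U₂ L b = prefixLen U₁ U₂ L c := by
  obtain ⟨u, z, v, hw, hu⟩ := hb.exists_split
  obtain ⟨u', z', v', hw', hu'⟩ := hc.exists_split
  rw [letter_of_split hw hu, letter_of_split hw' hu', Option.some_inj] at h
  rw [prefixLen_pred_of_split hw hu, prefixLen_pred_of_split hw' hu'] at hlo
  rw [prefixLen_of_split hb.2.1 hw hu, prefixLen_of_split hc.2.1 hw' hu', hlo, h]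

theorem prefixLen_pos {b : ℕ × ℕ} (hL : ∀ x, 0 < L x) (hb : Boundary U₁ U₂ b) :
    0 < prefixLen U₁ U₂ L b := by
  obtain ⟨u, z, v, hw, hu⟩ := hb.exists_split
  rw [prefixLen_of_split hb.2.1 hw hu]
  exact Nat.add_pos_right _ (hL z)

end PrefixLen

section Realizes

variable {X : Type*} {U₁ U₂ : List X} {L : X → ℕ} {lt : BRel}

/-- The length assignment `L` is positive and induces `lt` on all boundaries, the conventional
ones included. -/
def Realizes (U₁ U₂ : List X) (lt : BRel) (L : X → ℕ) : Prop :=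
  (∀ x, 0 < L x) ∧ ∀ a b, EBoundary U₁ U₂ a → EBoundary U₁ U₂ b →
    (lt a b ↔ prefixLen U₁ U₂ L a < prefixLen U₁ U₂ L b)

theorem EBoundary.eq_zero_or_boundary {b : ℕ × ℕ} (h : EBoundary U₁ U₂ b) :
    b = (1, 0) ∨ b = (2, 0) ∨ Boundary U₁ U₂ b := by
  obtain ⟨i, j⟩ := b
  rcases j with _ | j
  · rcases h.1 with h | h <;> simp_all
  · exact .inr (.inr ⟨h.1, Nat.succ_pos j, h.2⟩)

theorem BoundaryOrder.zero_lt (h : BoundaryOrder U₁ U₂ lt) {i : ℕ} (hi : i = 1 ∨ i = 2)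
    {b : ℕ × ℕ} (hb : Boundary U₁ U₂ b) : lt (i, 0) b := by
  have hz : ∀ k, k = 1 ∨ k = 2 → EBoundary U₁ U₂ (k, 0) := fun k hk => ⟨hk, Nat.zero_le _⟩
  have same : ∀ k j, EBoundary U₁ U₂ (k, j + 1) → lt (k, 0) (k, j + 1) := by
    intro k j
    induction j with
    | zero => exact h.succ k 0
    | succ j ih =>
      intro hj
      have hj' : EBoundary U₁ U₂ (k, j + 1) := ⟨hj.1, (Nat.le_succ _).trans hj.2⟩
      exact h.trans _ _ _ (hz k hj.1) hj' hj (ih hj') (h.succ k _ hj)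
  have hbot : Incomp lt (i, 0) (b.1, 0) := by
    have h1 := h.irrefl _ (hz 1 (.inl rfl))
    have h2 := h.irrefl _ (hz 2 (.inr rfl))
    rcases hi with rfl | rfl <;> rcases hb.1 with h' | h' <;> rw [h']
    exacts [⟨h1, h1⟩, h.bot, h.bot.symm, ⟨h2, h2⟩]
  have hlt : lt (b.1, 0) b := by
    obtain ⟨k, j⟩ := b
    obtain ⟨j, rfl⟩ : ∃ j', j = j' + 1 := Nat.exists_eq_add_of_le' hb.2.1
    exact same k j hb.eBoundary
  by_contra hn
  by_cases hn' : lt b (i, 0)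
  · exact hbot.2 (h.trans _ _ _ (hz _ hb.1) hb.eBoundary (hz i hi) hlt hn')
  · exact (h.incomp_trans _ _ _ (hz _ hb.1) (hz i hi) hb.eBoundary hbot.symm ⟨hn, hn'⟩).1 hlt

theorem BoundaryOrder.not_lt_zero (h : BoundaryOrder U₁ U₂ lt) {i : ℕ} (hi : i = 1 ∨ i = 2)
    {b : ℕ × ℕ} (hb : Boundary U₁ U₂ b) : ¬ lt b (i, 0) := fun hn =>
  have hz : EBoundary U₁ U₂ (i, 0) := ⟨hi, Nat.zero_le _⟩
  h.irrefl _ hz (h.trans _ _ _ hz hb.eBoundary hz (h.zero_lt hi hb) hn)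

theorem Coherent.exists_realizes (h : BoundaryOrder U₁ U₂ lt) (hc : Coherent U₁ U₂ lt) :
    ∃ L, Realizes U₁ U₂ lt L := by
  obtain ⟨L, hL, hlt⟩ := hc
  refine ⟨L, hL, fun a b ha hb => ?_⟩
  have h1 := h.irrefl (1, 0) ⟨.inl rfl, Nat.zero_le _⟩
  have h2 := h.irrefl (2, 0) ⟨.inr rfl, Nat.zero_le _⟩
  rcases ha.eq_zero_or_boundary with rfl | rfl | ha' <;>
  rcases hb.eq_zero_or_boundary with rfl | rfl | hb'
  · simp [h1]
  · simp [h.bot.1, prefixLen_zero]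
  · simp [h.zero_lt (.inl rfl) hb', prefixLen_zero, prefixLen_pos hL hb']
  · simp [h.bot.2, prefixLen_zero]
  · simp [h2]
  · simp [h.zero_lt (.inr rfl) hb', prefixLen_zero, prefixLen_pos hL hb']
  · simp [h.not_lt_zero (.inl rfl) ha', prefixLen_zero]
  · simp [h.not_lt_zero (.inr rfl) ha', prefixLen_zero]
  · exact hlt a b ha' hb'

/-- The edges of the cut graph, expressed through lengths of prefixes. -/
def LenEdge (U₁ U₂ : List X) (L : X → ℕ) (a b : ℕ × ℕ) : Prop :=
  ∃ c, (Boundary U₁ U₂ a ∧ Boundary U₁ U₂ c ∧ a.1 ≠ c.1 ∧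
      prefixLen U₁ U₂ L (a.1, a.2 - 1) < prefixLen U₁ U₂ L c ∧
      prefixLen U₁ U₂ L (c.1, c.2 - 1) < prefixLen U₁ U₂ L a) ∧
    Boundary U₁ U₂ b ∧ letter U₁ U₂ c = letter U₁ U₂ b ∧
      prefixLen U₁ U₂ L (c.1, c.2 - 1) ≠ prefixLen U₁ U₂ L (b.1, b.2 - 1)

theorem Realizes.incomp_iff (h : Realizes U₁ U₂ lt L) {a b : ℕ × ℕ} (ha : EBoundary U₁ U₂ a)
    (hb : EBoundary U₁ U₂ b) :
    Incomp lt a b ↔ prefixLen U₁ U₂ L a = prefixLen U₁ U₂ L b := by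
  rw [Incomp, h.2 a b ha hb, h.2 b a hb ha]
  omega

theorem Realizes.cutEdge_iff (h : Realizes U₁ U₂ lt L) (a b : ℕ × ℕ) :
    CutEdge U₁ U₂ lt a b ↔ LenEdge U₁ U₂ L a b := by
  constructor
  · rintro ⟨c, ⟨ha, hc, hne, h1, h2⟩, -, hb, hl, hm⟩
    rw [h.2 _ _ ha.eBoundary_pred hc.eBoundary] at h1
    rw [h.2 _ _ hc.eBoundary_pred ha.eBoundary] at h2
    rw [h.incomp_iff hc.eBoundary hb.eBoundary,
      h.incomp_iff hc.eBoundary_pred hb.eBoundary_pred] at hm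
    refine ⟨c, ⟨ha, hc, fun hs => ?_, h1, h2⟩, hb, hl, fun he => ?_⟩
    · obtain ⟨i, j⟩ := a
      obtain ⟨i', k⟩ := c
      obtain rfl : i = i' := hs
      rcases lt_trichotomy j k with hjk | rfl | hjk
      · exact h2.not_ge (prefixLen_mono (Nat.le_sub_one_of_lt hjk))
      · exact hne rfl
      · exact h1.not_ge (prefixLen_mono (Nat.le_sub_one_of_lt hjk))
    · exact hm.elim (· (letter_inj_prefixLen hc hb hl he)) (· he)
  · rintro ⟨c, ⟨ha, hc, hne, h1, h2⟩, hb, hl, hm⟩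
    refine ⟨c, ⟨ha, hc, fun he => hne (congrArg Prod.fst he),
      (h.2 _ _ ha.eBoundary_pred hc.eBoundary).2 h1,
      (h.2 _ _ hc.eBoundary_pred ha.eBoundary).2 h2⟩, hc, hb, hl, .inr ?_⟩
    rwa [h.incomp_iff hc.eBoundary_pred hb.eBoundary_pred]

theorem LenEdge.boundary_left {a b : ℕ × ℕ} (h : LenEdge U₁ U₂ L a b) : Boundary U₁ U₂ a :=
  h.choose_spec.1.1

theorem LenEdge.boundary_right {a b : ℕ × ℕ} (h : LenEdge U₁ U₂ L a b) : Boundary U₁ U₂ b :=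
  h.choose_spec.2.1

theorem exists_isCycle_iff {α : Type*} {R : α → α → Prop} :
    (∃ (n : ℕ) (w : ℕ → α), 0 < n ∧ w n = w 0 ∧ ∀ k < n, R (w k) (w (k + 1))) ↔
      ∃ a, Relation.TransGen R a a := by
  constructor
  · rintro ⟨n, w, hn, hw, hR⟩
    have key : ∀ k < n, Relation.TransGen R (w 0) (w (k + 1)) := by
      intro k
      induction k with
      | zero => exact fun h0 => .single (hR 0 h0)
      | succ k ih => exact fun hk => (ih (by omega)).tail (hR _ hk)
    refine ⟨w 0, ?_⟩
    have := key (n - 1) (by omega)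
    rwa [Nat.sub_add_cancel hn, hw] at this
  · rintro ⟨a, ha⟩
    have key : ∀ b, Relation.TransGen R a b →
        ∃ (n : ℕ) (w : ℕ → α), 0 < n ∧ w 0 = a ∧ w n = b ∧ ∀ k < n, R (w k) (w (k + 1)) := by
      intro b hb
      induction hb with
      | single h => exact ⟨1, fun k => if k = 0 then a else _, by simp, by simp, rfl, by simpa⟩
      | @tail b c _ h ih =>
        obtain ⟨n, w, hn, h0, hwn, hw⟩ := ih
        refine ⟨n + 1, fun k => if k ≤ n then w k else c, by omega, by simpa, by simp, ?_⟩
        intro k hk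
        rcases Nat.lt_succ_iff_lt_or_eq.1 hk with hk' | rfl
        · simpa [hk'.le, Nat.succ_le_of_lt hk'] using hw k hk'
        · simpa [hwn] using h
    obtain ⟨n, w, hn, h0, hwn, hw⟩ := key a ha
    exact ⟨n, w, hn, hwn.trans h0.symm, hw⟩

theorem Realizes.acyclic_iff (h : Realizes U₁ U₂ lt L) :
    Acyclic U₁ U₂ lt ↔ ∀ a, ¬ Relation.TransGen (LenEdge U₁ U₂ L) a a := by
  have hR : CutEdge U₁ U₂ lt = LenEdge U₁ U₂ L := by
    ext a b
    exact h.cutEdge_iff a b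
  rw [← not_exists, ← exists_isCycle_iff, ← hR]
  rfl

theorem lt_prefixLen_of_bminus {M : X → ℕ} {x y : X} (hx : U₁.head? = some x) (hy : U₂.head? = some y)
    (hM : ∀ z, 0 < M z) (hMxy : M y < M x) {b : ℕ × ℕ} (hb : Bminus U₁ U₂ b) :
    M y < prefixLen U₁ U₂ M b := by
  obtain ⟨⟨h1, h2, h3⟩, hne⟩ := hb
  obtain ⟨i, j⟩ := b
  simp only at h1 h2 h3
  rcases h1 with rfl | rfl
  · have hx1 : prefixLen U₁ U₂ M (1, 1) = M x := prefixLen_one (by simpa [word] using hx)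
    have := prefixLen_mono (U₁ := U₁) (U₂ := U₂) (L := M) (i := 1) h2
    omega
  · obtain ⟨v₂, rfl⟩ := List.head?_eq_some_iff.1 hy
    obtain ⟨j, rfl⟩ : ∃ j', j = j' + 1 := Nat.exists_eq_add_of_le' h2
    have hj : j ≠ 0 := by rintro rfl; exact hne rfl
    rcases v₂ with _ | ⟨t, v⟩
    · simp [word] at h3
      omega
    · obtain ⟨j, rfl⟩ := Nat.exists_eq_succ_of_ne_zero hj
      have := hM t
      simp [prefixLen, word]
      omega

end Realizes

section Dual

variable {X : Type*} {U₁ U₂ : List X} {L : X → ℕ} {lt : BRel}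

theorem word_dual {i : ℕ} (hi : i = 1 ∨ i = 2) : word U₂ U₁ (3 - i) = word U₁ U₂ i := by
  rcases hi with rfl | rfl <;> simp [word]

theorem EBoundary.dual {b : ℕ × ℕ} (h : EBoundary U₁ U₂ b) : EBoundary U₂ U₁ (3 - b.1, b.2) :=
  ⟨by have := h.1; simp only; omega, by simpa only [word_dual h.1] using h.2⟩

theorem Boundary.dual {b : ℕ × ℕ} (h : Boundary U₁ U₂ b) : Boundary U₂ U₁ (3 - b.1, b.2) :=
  ⟨h.eBoundary.dual.1, h.2.1, h.eBoundary.dual.2⟩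

theorem prefixLen_dual {b : ℕ × ℕ} (h : b.1 = 1 ∨ b.1 = 2) :
    prefixLen U₂ U₁ L (3 - b.1, b.2) = prefixLen U₁ U₂ L b := by
  simp only [prefixLen, word_dual h]

theorem letter_dual {b : ℕ × ℕ} (h : b.1 = 1 ∨ b.1 = 2) :
    letter U₂ U₁ (3 - b.1, b.2) = letter U₁ U₂ b := by
  simp only [letter, word_dual h]

theorem Realizes.dual (h : Realizes U₁ U₂ lt L) : Realizes U₂ U₁ (dualRel lt) L := by
  refine ⟨h.1, fun a b ha hb => ?_⟩
  rw [dualRel, h.2 _ _ ha.dual hb.dual, prefixLen_dual ha.1, prefixLen_dual hb.1]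

theorem LenEdge.dual {a b : ℕ × ℕ} (h : LenEdge U₁ U₂ L a b) :
    LenEdge U₂ U₁ L (3 - a.1, a.2) (3 - b.1, b.2) := by
  obtain ⟨c, ⟨ha, hc, hne, h1, h2⟩, hb, hl, hm⟩ := h
  refine ⟨(3 - c.1, c.2), ⟨ha.dual, hc.dual, ?_, ?_, ?_⟩, hb.dual, ?_, ?_⟩
  · have := ha.1
    have := hc.1
    simp only
    omega
  · rw [prefixLen_dual hc.1]
    exact (prefixLen_dual (b := (a.1, a.2 - 1)) ha.1).trans_lt h1
  · rw [prefixLen_dual ha.1]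
    exact (prefixLen_dual (b := (c.1, c.2 - 1)) hc.1).trans_lt h2
  · rwa [letter_dual hc.1, letter_dual hb.1]
  · exact (prefixLen_dual (b := (c.1, c.2 - 1)) hc.1).trans_ne
      (hm.trans_eq (prefixLen_dual (b := (b.1, b.2 - 1)) hb.1).symm)

theorem dualRel_dual {a b : ℕ × ℕ} (ha : a.1 = 1 ∨ a.1 = 2) (hb : b.1 = 1 ∨ b.1 = 2) :
    dualRel lt (3 - a.1, a.2) (3 - b.1, b.2) ↔ lt a b := by
  have hsub : ∀ n, n = 1 ∨ n = 2 → 3 - (3 - n) = n := by omega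
  simp only [dualRel, hsub _ ha, hsub _ hb, Prod.mk.eta]

theorem incomp_dualRel_dual {a b : ℕ × ℕ} (ha : a.1 = 1 ∨ a.1 = 2) (hb : b.1 = 1 ∨ b.1 = 2) :
    Incomp (dualRel lt) (3 - a.1, a.2) (3 - b.1, b.2) ↔ Incomp lt a b := by
  rw [Incomp, dualRel_dual ha hb, dualRel_dual hb ha, Incomp]

theorem BoundaryOrder.of_dual (h : BoundaryOrder U₂ U₁ (dualRel lt)) :
    BoundaryOrder U₁ U₂ lt where
  irrefl a ha := by
    simpa only [dualRel_dual ha.1 ha.1] using h.irrefl _ ha.dual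
  trans a b c ha hb hc := by
    simpa only [dualRel_dual ha.1 hb.1, dualRel_dual hb.1 hc.1, dualRel_dual ha.1 hc.1] using
      h.trans _ _ _ ha.dual hb.dual hc.dual
  incomp_trans a b c ha hb hc := by
    simpa only [incomp_dualRel_dual ha.1 hb.1, incomp_dualRel_dual hb.1 hc.1,
      incomp_dualRel_dual ha.1 hc.1] using h.incomp_trans _ _ _ ha.dual hb.dual hc.dual
  succ i j hj := (dualRel_dual (a := (i, j)) hj.1 hj.1).1 (h.succ _ _ hj.dual)
  top := h.top.symm
  bot := h.bot.symm

theorem Realizes.acyclic_dual_iff (h : Realizes U₁ U₂ lt L) :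
    Acyclic U₂ U₁ (dualRel lt) ↔ Acyclic U₁ U₂ lt := by
  rw [h.acyclic_iff, h.dual.acyclic_iff]
  exact ⟨fun H a ha => H _ (ha.lift (fun b : ℕ × ℕ => (3 - b.1, b.2)) fun _ _ => LenEdge.dual),
    fun H a ha => H _ (ha.lift (fun b : ℕ × ℕ => (3 - b.1, b.2)) fun _ _ => LenEdge.dual)⟩

end Dual

section Lift

variable {X : Type*} {U₁ U₂ U₁' U₂' : List X} {L M : X → ℕ} {x y : X}

/-- A map of boundaries that enlarges the corresponding intervals (up to a shift by `d`) sends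
edges to paths, if it preserves letters except for possible confusion of the two heads. -/
theorem LenEdge.lift (hx : U₁.head? = some x) (hy : U₂.head? = some y) (hM : ∀ z, 0 < M z)
    (d : ℕ) (φ : ℕ × ℕ → ℕ × ℕ)
    (hφ : ∀ b, Boundary U₁' U₂' b → Boundary U₁ U₂ (φ b) ∧ (φ b).1 = b.1 ∧
      prefixLen U₁ U₂ M ((φ b).1, (φ b).2 - 1) ≤ prefixLen U₁' U₂' L (b.1, b.2 - 1) + d ∧
      prefixLen U₁' U₂' L b + d ≤ prefixLen U₁ U₂ M (φ b))
    (hmir : ∀ c b, Boundary U₁' U₂' c → Boundary U₁' U₂' b →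
      letter U₁' U₂' c = letter U₁' U₂' b →
      prefixLen U₁' U₂' L (c.1, c.2 - 1) ≠ prefixLen U₁' U₂' L (b.1, b.2 - 1) →
      letter U₁ U₂ (φ c) = letter U₁ U₂ (φ b) ∧
        prefixLen U₁ U₂ M ((φ c).1, (φ c).2 - 1) ≠ prefixLen U₁ U₂ M ((φ b).1, (φ b).2 - 1) ∨
      (letter U₁ U₂ (φ c) = some x ∧ letter U₁ U₂ (φ b) = some y ∨
        letter U₁ U₂ (φ c) = some y ∧ letter U₁ U₂ (φ b) = some x) ∧
        0 < prefixLen U₁ U₂ M ((φ c).1, (φ c).2 - 1) ∧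
        0 < prefixLen U₁ U₂ M ((φ b).1, (φ b).2 - 1))
    {a b : ℕ × ℕ} (h : LenEdge U₁' U₂' L a b) :
    Relation.TransGen (LenEdge U₁ U₂ M) (φ a) (φ b) := by
  obtain ⟨c, ⟨ha, hc, hne, h1, h2⟩, hb, hl, hm⟩ := h
  obtain ⟨hφa, ha1, ha2, ha3⟩ := hφ a ha
  obtain ⟨hφc, hc1, hc2, hc3⟩ := hφ c hc
  obtain ⟨hφb, -, -, -⟩ := hφ b hb
  have hcut : Boundary U₁ U₂ (φ a) ∧ Boundary U₁ U₂ (φ c) ∧ (φ a).1 ≠ (φ c).1 ∧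
      prefixLen U₁ U₂ M ((φ a).1, (φ a).2 - 1) < prefixLen U₁ U₂ M (φ c) ∧
      prefixLen U₁ U₂ M ((φ c).1, (φ c).2 - 1) < prefixLen U₁ U₂ M (φ a) :=
    ⟨hφa, hφc, by rwa [ha1, hc1], by omega, by omega⟩
  obtain ⟨v₁, rfl⟩ := List.head?_eq_some_iff.1 hx
  obtain ⟨v₂, rfl⟩ := List.head?_eq_some_iff.1 hy
  have hb1 : Boundary (x :: v₁) (y :: v₂) (1, 1) := ⟨.inl rfl, le_rfl, by simp [word]⟩
  have hb2 : Boundary (x :: v₁) (y :: v₂) (2, 1) := ⟨.inr rfl, le_rfl, by simp [word]⟩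
  have hl1 : letter (x :: v₁) (y :: v₂) (1, 1) = some x := by simp [letter, word]
  have hl2 : letter (x :: v₁) (y :: v₂) (2, 1) = some y := by simp [letter, word]
  have hp1 := prefixLen_pos hM hb1
  have hp2 := prefixLen_pos hM hb2
  rcases hmir c b hc hb hl hm with ⟨h3, h4⟩ | ⟨⟨h3, h4⟩ | ⟨h3, h4⟩, h5, h6⟩
  · exact .single ⟨φ c, hcut, hφb, h3, h4⟩
  · refine .tail (b := (1, 1)) (.single ⟨φ c, hcut, hb1, h3.trans hl1.symm, ?_⟩)
      ⟨(2, 1), ⟨hb1, hb2, by simp, ?_, ?_⟩, hφb, hl2.trans h4.symm, ?_⟩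
    all_goals simp only [Nat.sub_self, prefixLen_zero]; omega
  · refine .tail (b := (2, 1)) (.single ⟨φ c, hcut, hb2, h3.trans hl2.symm, ?_⟩)
      ⟨(1, 1), ⟨hb2, hb1, by simp, ?_, ?_⟩, hφb, hl1.trans h4.symm, ?_⟩
    all_goals simp only [Nat.sub_self, prefixLen_zero]; omega

theorem forall_not_transGen_of_lift {φ : ℕ × ℕ → ℕ × ℕ}
    (hlift : ∀ a b, LenEdge U₁' U₂' L a b →
      Relation.TransGen (LenEdge U₁ U₂ M) (φ a) (φ b))
    (hacyc : ∀ a, ¬ Relation.TransGen (LenEdge U₁ U₂ M) a a) (a : ℕ × ℕ) :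
    ¬ Relation.TransGen (LenEdge U₁' U₂' L) a a := fun ha =>
  hacyc (φ a) (Relation.TransGen.lift' φ hlift a a ha)

end Lift

section CaseI

variable {X : Type*} [DecidableEq X] {U₁ U₂ U₁' U₂' : List X} {lt lt' : BRel} {L L₀ : X → ℕ}

theorem NielsenI.acyclic (hN : NielsenI U₁ U₂ lt U₁' U₂' lt') (h₀ : Realizes U₁ U₂ lt L₀)
    (h' : Realizes U₁' U₂' lt' L) (hacyc : Acyclic U₁ U₂ lt) : Acyclic U₁' U₂' lt' := by
  obtain ⟨x, y, hx, hy, hinc, h₁, h₂, -, hlt⟩ := hN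
  set T : X → X := fun z => if z = y then x else z with hT
  set M : X → ℕ := fun z => L (T z) with hMdef
  have hMpos : ∀ z, 0 < M z := fun z => h'.1 _
  have hTx : T x = x := by by_cases h : x = y <;> simp [hT, h]
  have hTy : T y = x := by simp [hT]
  have hne : ∀ i, ∃ z v, word U₁ U₂ i = z :: v ∧ T z = x := by
    obtain ⟨v₁, rfl⟩ := List.head?_eq_some_iff.1 hx
    obtain ⟨v₂, rfl⟩ := List.head?_eq_some_iff.1 hy
    intro i
    by_cases hi : i = 1
    · exact ⟨x, v₁, by simp [word, hi], hTx⟩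
    · exact ⟨y, v₂, by simp [word, hi], hTy⟩
  have hword : ∀ i, word U₁' U₂' i = ((word U₁ U₂ i).map T).tail := by
    intro i
    simp only [word, h₁, h₂]
    split_ifs <;> rfl
  have hpre : ∀ i j, prefixLen U₁ U₂ M (i, j + 1) = prefixLen U₁' U₂' L (i, j) + L x := by
    intro i j
    obtain ⟨z, v, hv, hz⟩ := hne i
    simp only [prefixLen, hword, hv]
    simp only [List.take_succ_cons, List.map_cons, List.sum_cons, List.tail_cons, ← List.map_take,
      List.map_map, hMdef, hz]
    rw [add_comm]
    rfl
  have hEB : ∀ i j, EBoundary U₁ U₂ (i, j + 1) ↔ EBoundary U₁' U₂' (i, j) := by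
    intro i j
    obtain ⟨z, v, hv, hz⟩ := hne i
    simp [EBoundary, hword, hv]
  have hletter : ∀ b : ℕ × ℕ, 1 ≤ b.2 →
      letter U₁' U₂' b = (letter U₁ U₂ (b.1, b.2 + 1)).map T := by
    rintro ⟨i, j⟩ hj
    obtain ⟨z, v, hv, hz⟩ := hne i
    obtain ⟨j, rfl⟩ : ∃ j', j = j' + 1 := Nat.exists_eq_add_of_le' hj
    simp [letter, hword, hv]
  have hM : Realizes U₁ U₂ lt M := by
    have hlow : ∀ i j, EBoundary U₁ U₂ (i, j + 1) → L₀ x ≤ prefixLen U₁ U₂ L₀ (i, j + 1) := by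
      have hx1 : prefixLen U₁ U₂ L₀ (1, 1) = L₀ x := prefixLen_one (by simpa [word] using hx)
      have hy1 : prefixLen U₁ U₂ L₀ (2, 1) = L₀ y := prefixLen_one (by simpa [word] using hy)
      rw [h₀.incomp_iff] at hinc
      · intro i j hij
        have := prefixLen_mono (U₁ := U₁) (U₂ := U₂) (L := L₀) (i := i) (Nat.le_add_left 1 j)
        rcases hij.1 with h | h <;> simp only at h <;> subst h <;> omega
      · exact (hEB 1 0).2 ⟨.inl rfl, Nat.zero_le _⟩
      · exact (hEB 2 0).2 ⟨.inr rfl, Nat.zero_le _⟩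
    refine ⟨hMpos, ?_⟩
    rintro ⟨i, j⟩ ⟨i', k⟩ ha hb
    have hx0 := h₀.1 x
    have hx0' := h'.1 x
    rcases j with _ | j <;> rcases k with _ | k
    · rw [h₀.2 _ _ ha hb]
      simp [prefixLen_zero]
    · rw [h₀.2 _ _ ha hb, hpre, prefixLen_zero, prefixLen_zero]
      have := hlow _ _ hb
      omega
    · rw [h₀.2 _ _ ha hb, hpre, prefixLen_zero, prefixLen_zero]
      omega
    · rw [hpre, hpre, ← hlt (i, j) (i', k) ((hEB _ _).1 ha) ((hEB _ _).1 hb),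
        h'.2 _ _ ((hEB _ _).1 ha) ((hEB _ _).1 hb)]
      omega
  rw [hM.acyclic_iff] at hacyc
  rw [h'.acyclic_iff]
  refine forall_not_transGen_of_lift (φ := fun b => (b.1, b.2 + 1)) (fun a b => ?_) hacyc
  refine LenEdge.lift hx hy hMpos (L x) (fun b => (b.1, b.2 + 1)) ?_ ?_
  · intro b hb
    have hlo := hpre b.1 (b.2 - 1)
    rw [Nat.sub_add_cancel hb.2.1] at hlo
    exact ⟨⟨hb.1, Nat.le_add_left _ _, ((hEB _ _).2 hb.eBoundary).2⟩, rfl, hlo.le,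
      (hpre b.1 b.2).ge⟩
  · intro c b hc hb hl hm
    have hloc := hpre c.1 (c.2 - 1)
    have hlob := hpre b.1 (b.2 - 1)
    rw [Nat.sub_add_cancel hc.2.1] at hloc
    rw [Nat.sub_add_cancel hb.2.1] at hlob
    have hx0 := h'.1 x
    simp only [Nat.add_sub_cancel]
    rw [hletter c hc.2.1, hletter b hb.2.1] at hl
    have hex : ∀ b, Boundary U₁' U₂' b → ∃ z, letter U₁ U₂ (b.1, b.2 + 1) = some z := by
      intro b hb
      have hB : Boundary U₁ U₂ (b.1, b.2 + 1) :=
        ⟨hb.1, Nat.le_add_left _ _, ((hEB _ _).2 hb.eBoundary).2⟩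
      obtain ⟨u, z, v, hw, hu⟩ := hB.exists_split
      exact ⟨z, letter_of_split hw hu⟩
    obtain ⟨z, hz⟩ := hex c hc
    obtain ⟨z', hz'⟩ := hex b hb
    rw [hz, hz', Option.map_some, Option.map_some, Option.some_inj] at hl
    rw [hz, hz']
    by_cases hzz : z = z'
    · exact .inl ⟨by rw [hzz], by omega⟩
    · refine .inr ⟨?_, by omega, by omega⟩
      simp only [hT] at hl
      simp only [Option.some_inj]
      split_ifs at hl <;> simp_all

end CaseI

section CaseII

variable {X : Type*} [DecidableEq X] {U₁ U₂ U₁' U₂' : List X} {lt lt' : BRel} {L L₀ : X → ℕ}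
  {x y : X}

theorem expand_append (u v : List X) : expand x y (u ++ v) = expand x y u ++ expand x y v := by
  simp [expand]

theorem expand_cons (z : X) (v : List X) :
    expand x y (z :: v) = (if z = x then [y, x] else [z]) ++ expand x y v := by
  simp [expand]

theorem length_expand (w : List X) : (expand x y w).length = w.length + w.count x := by
  induction w with
  | nil => rfl
  | cons z w ih =>
    rw [expand_cons, List.length_append, ih, List.count_cons]
    by_cases h : z = x <;> simp [h] <;> omega

theorem count_expand (hxy : y ≠ x) (w : List X) : (expand x y w).count x = w.count x := by
  induction w with
  | nil => rfl
  | cons z w ih =>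
    rw [expand_cons, List.count_append, ih, List.count_cons]
    by_cases h : z = x <;> simp [h, hxy, add_comm]

theorem sum_map_expand (w : List X) : ((expand x y w).map L).sum =
    (w.map fun z => if z = x then L y + L x else L z).sum := by
  induction w with
  | nil => rfl
  | cons z w ih =>
    rw [expand_cons, List.map_append, List.sum_append, ih]
    by_cases h : z = x <;> simp [h]

/-- Every letter of `expand x y w` comes from a letter of `w`. -/
theorem exists_split_of_expand_eq {w p q : List X} {z' : X}
    (h : expand x y w = p ++ z' :: q) : ∃ u z v, w = u ++ z :: v ∧
      (z ≠ x ∧ z' = z ∧ p = expand x y u ∨ z = x ∧ z' = y ∧ p = expand x y u ∨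
        z = x ∧ z' = x ∧ p = expand x y u ++ [y]) := by
  induction w generalizing p with
  | nil => simp [expand] at h
  | cons t w ih =>
    have shift : ∀ p', expand x y w = p' ++ z' :: q →
        p = (if t = x then [y, x] else [t]) ++ p' → ∃ u z v, t :: w = u ++ z :: v ∧
        (z ≠ x ∧ z' = z ∧ p = expand x y u ∨ z = x ∧ z' = y ∧ p = expand x y u ∨
          z = x ∧ z' = x ∧ p = expand x y u ++ [y]) := by
      rintro p' hp' rfl
      obtain ⟨u, z, v, rfl, hu⟩ := ih hp'
      refine ⟨t :: u, z, v, rfl, ?_⟩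
      simpa only [expand_cons, List.append_assoc, List.append_cancel_left_eq] using hu
    rw [expand_cons] at h
    by_cases ht : t = x
    · subst ht
      rcases p with _ | ⟨a, _ | ⟨b, p⟩⟩
      · simp only [if_true, List.cons_append, List.nil_append, List.cons.injEq] at h
        exact ⟨[], t, w, rfl, .inr (.inl ⟨rfl, h.1.symm, rfl⟩)⟩
      · simp only [if_true, List.cons_append, List.nil_append, List.cons.injEq] at h
        exact ⟨[], t, w, rfl, .inr (.inr ⟨rfl, h.2.1.symm, by rw [← h.1]; rfl⟩)⟩
      · simp only [if_true, List.cons_append, List.nil_append, List.cons.injEq] at h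
        exact shift p h.2.2 (by simp [h.1, h.2.1])
    · rcases p with _ | ⟨a, p⟩
      · simp only [if_neg ht, List.cons_append, List.nil_append, List.cons.injEq] at h
        exact ⟨[], t, w, rfl, .inl ⟨ht, h.1.symm, rfl⟩⟩
      · simp only [if_neg ht, List.cons_append, List.nil_append, List.cons.injEq] at h
        exact shift p h.2 (by rw [if_neg ht, h.1]; rfl)

theorem NielsenIIxy.word_eq (hN : NielsenIIxy U₁ U₂ lt U₁' U₂' lt' x y) (i : ℕ) :
    expand x y (word U₁ U₂ i) = y :: word U₁' U₂' i := by
  obtain ⟨hx, hy, -, h₁, h₂, -⟩ := hN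
  obtain ⟨v₁, rfl⟩ := List.head?_eq_some_iff.1 hx
  obtain ⟨v₂, rfl⟩ := List.head?_eq_some_iff.1 hy
  by_cases hi : i = 1
  · simp [word, hi, h₁, expand_cons]
  · by_cases hyx : y = x <;> simp [word, hi, h₂, expand_cons, hyx]

/-- The prefixes of the two words correspond under `mu`. -/
theorem NielsenIIxy.expand_take (hN : NielsenIIxy U₁ U₂ lt U₁' U₂' lt' x y) {b : ℕ × ℕ}
    (hb : Boundary U₁ U₂ b) : expand x y ((word U₁ U₂ b.1).take b.2) =
      y :: (word U₁' U₂' b.1).take (mu U₁ U₂ x b).2 := by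
  have hpre : expand x y ((word U₁ U₂ b.1).take b.2) <+: expand x y (word U₁ U₂ b.1) := by
    conv_rhs => rw [← List.take_append_drop b.2 (word U₁ U₂ b.1), expand_append]
    exact List.prefix_append _ _
  rw [hN.word_eq, List.prefix_iff_eq_take, length_expand, List.length_take,
    min_eq_left hb.2.2] at hpre
  rw [hpre, ← List.take_succ_cons]
  congr 1
  have := hb.2.1
  simp only [mu]
  omega

theorem NielsenIIxy.eBoundary_mu (hN : NielsenIIxy U₁ U₂ lt U₁' U₂' lt' x y) {b : ℕ × ℕ}
    (hb : Boundary U₁ U₂ b) : EBoundary U₁' U₂' (mu U₁ U₂ x b) := by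
  refine ⟨hb.1, ?_⟩
  have h1 := congrArg List.length (hN.word_eq b.1)
  rw [length_expand, List.length_cons] at h1
  have h2 := (List.take_sublist b.2 (word U₁ U₂ b.1)).count_le x
  have h3 := hb.2.2
  simp only [mu]
  omega

theorem NielsenIIxy.nu_mu (hN : NielsenIIxy U₁ U₂ lt U₁' U₂' lt' x y) (hxy : y ≠ x) {b : ℕ × ℕ}
    (hb : Boundary U₁ U₂ b) : nu U₁' U₂' x (mu U₁ U₂ x b) = b := by
  have h := congrArg (List.count x) (hN.expand_take hb)
  rw [count_expand hxy, List.count_cons_of_ne hxy] at h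
  have := hb.2.1
  refine Prod.ext rfl ?_
  change (mu U₁ U₂ x b).2 - ((word U₁' U₂' b.1).take (mu U₁ U₂ x b).2).count x + 1 = b.2
  rw [← h]
  simp only [mu]
  omega

theorem NielsenIIxy.prefixLen_mu (hN : NielsenIIxy U₁ U₂ lt U₁' U₂' lt' x y) {b : ℕ × ℕ}
    (hb : Boundary U₁ U₂ b) :
    prefixLen U₁ U₂ (fun z => if z = x then L y + L x else L z) b =
      prefixLen U₁' U₂' L (mu U₁ U₂ x b) + L y := by
  rw [prefixLen, ← sum_map_expand, hN.expand_take hb, List.map_cons, List.sum_cons, add_comm]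
  rfl

theorem NielsenIIxy.ne (hN : NielsenIIxy U₁ U₂ lt U₁' U₂' lt' x y)
    (h₀ : Realizes U₁ U₂ lt L₀) : L₀ y < L₀ x ∧ y ≠ x := by
  obtain ⟨hx, hy, h21, -⟩ := hN
  have hx1 : prefixLen U₁ U₂ L₀ (1, 1) = L₀ x := prefixLen_one (by simpa [word] using hx)
  have hy1 : prefixLen U₁ U₂ L₀ (2, 1) = L₀ y := prefixLen_one (by simpa [word] using hy)
  obtain ⟨v₁, rfl⟩ := List.head?_eq_some_iff.1 hx
  obtain ⟨v₂, rfl⟩ := List.head?_eq_some_iff.1 hy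
  rw [h₀.2 _ _ ⟨.inr rfl, by simp [word]⟩ ⟨.inl rfl, by simp [word]⟩, hx1, hy1] at h21
  exact ⟨h21, by rintro rfl; exact h21.false⟩

theorem NielsenIIxy.realizes (hN : NielsenIIxy U₁ U₂ lt U₁' U₂' lt' x y)
    (h₀ : Realizes U₁ U₂ lt L₀) (h' : Realizes U₁' U₂' lt' L) :
    Realizes U₁ U₂ lt fun z => if z = x then L y + L x else L z := by
  obtain ⟨hlt₀, hyx⟩ := hN.ne h₀
  set M : X → ℕ := fun z => if z = x then L y + L x else L z with hMdef
  have hxL := h'.1 x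
  have hMpos : ∀ z, 0 < M z := fun z => by
    have := h'.1 z
    simp only [hMdef]
    split_ifs <;> omega
  have hMxy : M y < M x := by
    simp only [hMdef, if_neg hyx, if_true]
    omega
  have hx := hN.1
  have hy := hN.2.1
  have hsplit : ∀ b, EBoundary U₁ U₂ b → (∃ i, b = (i, 0)) ∨ b = (2, 1) ∨ Bminus U₁ U₂ b := by
    intro b hb
    rcases hb.eq_zero_or_boundary with h | h | h
    · exact .inl ⟨_, h⟩
    · exact .inl ⟨_, h⟩
    · by_cases h21 : b = (2, 1)
      · exact .inr (.inl h21)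
      · exact .inr (.inr ⟨h, h21⟩)
  have hy0 : prefixLen U₁ U₂ L₀ (2, 1) = L₀ y := prefixLen_one (by simpa [word] using hy)
  have hyM : prefixLen U₁ U₂ M (2, 1) = M y := prefixLen_one (by simpa [word] using hy)
  have hy0' := h₀.1 y
  have hyM' := hMpos y
  refine ⟨hMpos, fun a b ha hb => ?_⟩
  have low : ∀ c, Bminus U₁ U₂ c →
      L₀ y < prefixLen U₁ U₂ L₀ c ∧ M y < prefixLen U₁ U₂ M c := fun c hc =>
    ⟨lt_prefixLen_of_bminus hx hy h₀.1 hlt₀ hc, lt_prefixLen_of_bminus hx hy hMpos hMxy hc⟩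
  by_cases hab : Bminus U₁ U₂ a ∧ Bminus U₁ U₂ b
  · obtain ⟨ha', hb'⟩ := hab
    have h1 := hN.2.2.2.2.2.2 _ _ ⟨a, ha', rfl⟩ ⟨b, hb', rfl⟩
    rw [hN.nu_mu hyx ha'.1, hN.nu_mu hyx hb'.1,
      h'.2 _ _ (hN.eBoundary_mu ha'.1) (hN.eBoundary_mu hb'.1)] at h1
    rw [← h1, hN.prefixLen_mu ha'.1, hN.prefixLen_mu hb'.1]
    omega
  · rw [h₀.2 a b ha hb]
    rcases hsplit a ha with ⟨i, rfl⟩ | rfl | ha' <;>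
    rcases hsplit b hb with ⟨j, rfl⟩ | rfl | hb'
    case neg.inr.inr.inr.inr => exact absurd ⟨ha', hb'⟩ hab
    all_goals
      try have h1 := low _ ha'
      try have h2 := low _ hb'
      simp only [prefixLen_zero, hy0, hyM]
      try omega

theorem NielsenIIxy.exists_parent (hN : NielsenIIxy U₁ U₂ lt U₁' U₂' lt' x y) {b : ℕ × ℕ}
    (hb : Boundary U₁' U₂' b) :
    ∃ c z z', Boundary U₁ U₂ c ∧ c.1 = b.1 ∧ letter U₁ U₂ c = some z ∧
      letter U₁' U₂' b = some z' ∧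
      prefixLen U₁' U₂' L b = prefixLen U₁' U₂' L (b.1, b.2 - 1) + L z' ∧
      prefixLen U₁ U₂ (fun z => if z = x then L y + L x else L z) c =
        prefixLen U₁ U₂ (fun z => if z = x then L y + L x else L z) (c.1, c.2 - 1) +
          (if z = x then L y + L x else L z) ∧
      (z ≠ x ∧ z' = z ∧ prefixLen U₁ U₂ (fun z => if z = x then L y + L x else L z)
          (c.1, c.2 - 1) = prefixLen U₁' U₂' L (b.1, b.2 - 1) + L y ∨
        z = x ∧ z' = y ∧ prefixLen U₁ U₂ (fun z => if z = x then L y + L x else L z)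
          (c.1, c.2 - 1) = prefixLen U₁' U₂' L (b.1, b.2 - 1) + L y ∨
        z = x ∧ z' = x ∧ prefixLen U₁ U₂ (fun z => if z = x then L y + L x else L z)
          (c.1, c.2 - 1) = prefixLen U₁' U₂' L (b.1, b.2 - 1)) := by
  obtain ⟨p, z', q, hw, hp⟩ := hb.exists_split
  have he : expand x y (word U₁ U₂ b.1) = (y :: p) ++ z' :: q := by
    rw [hN.word_eq, hw, List.cons_append]
  obtain ⟨u, z, v, hw', hu⟩ := exists_split_of_expand_eq he
  have hlen : u.length = (b.1, u.length + 1).2 - 1 := rfl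
  refine ⟨(b.1, u.length + 1), z, z', boundary_of_split hb.1 (Nat.le_add_left _ _) hw' hlen, rfl,
    letter_of_split hw' hlen, letter_of_split hw hp, ?_, ?_, ?_⟩
  · rw [prefixLen_of_split hb.2.1 hw hp, prefixLen_pred_of_split hw hp]
  · rw [prefixLen_of_split (b := (b.1, u.length + 1)) (Nat.le_add_left _ _) hw' hlen,
      prefixLen_pred_of_split (b := (b.1, u.length + 1)) hw' hlen]
  · rw [prefixLen_pred_of_split (b := (b.1, u.length + 1)) hw' hlen,
      prefixLen_pred_of_split hw hp, ← sum_map_expand]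
    rcases hu with ⟨h1, h2, h3⟩ | ⟨h1, h2, h3⟩ | ⟨h1, h2, h3⟩
    · refine .inl ⟨h1, h2, ?_⟩
      rw [← h3, List.map_cons, List.sum_cons, add_comm]
    · refine .inr (.inl ⟨h1, h2, ?_⟩)
      rw [← h3, List.map_cons, List.sum_cons, add_comm]
    · refine .inr (.inr ⟨h1, h2, ?_⟩)
      have h4 := congrArg (fun l => (l.map L).sum) h3
      simp only [List.map_cons, List.sum_cons, List.map_append, List.sum_append, List.map_nil,
        List.sum_nil] at h4
      omega

theorem NielsenII.acyclic (hN : NielsenII U₁ U₂ lt U₁' U₂' lt') (h₀ : Realizes U₁ U₂ lt L₀)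
    (h' : Realizes U₁' U₂' lt' L) (hacyc : Acyclic U₁ U₂ lt) : Acyclic U₁' U₂' lt' := by
  obtain ⟨x, y, hN⟩ := hN
  have hM := hN.realizes h₀ h'
  have hyx := (hN.ne h₀).2
  rw [hM.acyclic_iff] at hacyc
  rw [h'.acyclic_iff]
  have hpar := fun b (hb : Boundary U₁' U₂' b) => hN.exists_parent (L := L) hb
  choose! φ t t' hB hside ht ht' hhi' hhi hcase using hpar
  have hypos := h'.1 y
  refine forall_not_transGen_of_lift (φ := φ) (fun a b => ?_) hacyc
  refine LenEdge.lift hN.1 hN.2.1 hM.1 (L y) φ (fun b hb => ⟨hB b hb, hside b hb, ?_⟩) ?_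
  · rw [hhi b hb, hhi' b hb]
    rcases hcase b hb with ⟨h1, h2, h3⟩ | ⟨h1, h2, h3⟩ | ⟨h1, h2, h3⟩ <;>
      rw [h3, h2] <;> simp [h1] <;> omega
  · intro c b hc hb hl hm
    rw [ht' c hc, ht' b hb, Option.some_inj] at hl
    rw [ht c hc, ht b hb]
    simp only [Option.some_inj]
    rcases hcase b hb with ⟨h1, h2, h3⟩ | ⟨h1, h2, h3⟩ | ⟨h1, h2, h3⟩ <;>
    rcases hcase c hc with ⟨h4, h5, h6⟩ | ⟨h4, h5, h6⟩ | ⟨h4, h5, h6⟩ <;>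
    rw [h3, h6] <;> grind

end CaseII

/-- **Proposition.** A coherent extended Nielsen transformation preserves
acyclicity of the cut graph. -/
theorem acyclic_preserved_by_coh_nielsen (U₁ U₂ U₁' U₂' : List X) (lt lt' : BRel)
    (h : CohNielsen U₁ U₂ lt U₁' U₂' lt') (hacyc : Acyclic U₁ U₂ lt) :
    Acyclic U₁' U₂' lt' := by
  obtain ⟨⟨-, -, hord, hcoh, hN⟩, hcoh'⟩ := h
  obtain ⟨L₀, h₀⟩ := hcoh.exists_realizes hord
  rcases hN with hN | hN | hN
  · have hord' : BoundaryOrder U₁' U₂' lt' := by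
      obtain ⟨_, _, _, _, _, _, _, h, _⟩ := hN
      exact h
    obtain ⟨L, h'⟩ := hcoh'.exists_realizes hord'
    exact hN.acyclic h₀ h' hacyc
  · have hord' : BoundaryOrder U₁' U₂' lt' := by
      obtain ⟨_, _, _, _, _, _, _, h, _⟩ := hN
      exact h
    obtain ⟨L, h'⟩ := hcoh'.exists_realizes hord'
    exact hN.acyclic h₀ h' hacyc
  · have hord' : BoundaryOrder U₂' U₁' (dualRel lt') := by
      obtain ⟨_, _, _, _, _, _, _, h, _⟩ := hN
      exact h
    obtain ⟨L, h'⟩ := hcoh'.exists_realizes hord'.of_dual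
    exact h'.acyclic_dual_iff.1 (NielsenII.acyclic hN h₀.dual h'.dual (h₀.acyclic_dual_iff.2 hacyc))

end ExtWordEq
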